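/- Let p be an odd prime, let G be a finite p-group such that G/Z(G) is p-central (every element of order p in G/Z(G) lies in the center of G/Z(G)), and let N be a nontrivial normal subgroup of G such that the quotient G/N is not cyclic. Then there exists a map f : G → G such that: (i) for every g ∈ G, f(g) lies in Z(N) = {n ∈ N : n commutes with every element of N}; (ii) f(xy) = (y⁻¹ f(x) y) · f(y) for all x, y ∈ G; (iii) f(n) = 1 for all n ∈ N; and (iv) there is no a ∈ Z(N) with f(g) = a⁻¹ · (g⁻¹ a g) for all g ∈ G. (This expresses that H¹(G/N, Z(N)) ≠ 0; it is the n = 1 instance of the paper's conclusion that the Tate cohomology Hⁿ(G/N, Z(N)) ≠ 0 for all n ≥ 0.) -/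

import Mathlib

section Bicyclic

open Finset

variable {M : Type*} [AddCommGroup M]

theorem pow_apply_sub_mem {X : AddMonoid.End M} {W : AddSubgroup M}
    (hW : ∀ w ∈ W, X w ∈ W) {d : M} (ht : X (X d - d) - (X d - d) ∈ W) (n : ℕ) :
    (X ^ n) d - (d + n • (X d - d)) ∈ W := by
  induction n with
  | zero => simp
  | succ n ih =>
    have h := add_mem (hW _ ih) (nsmul_mem ht n)
    rw [pow_succ', show (X * X ^ n) d = X ((X ^ n) d) from rfl]
    convert h using 1
    simp only [map_sub, map_add, map_nsmul, succ_nsmul, smul_sub]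
    abel

theorem geom_sum_apply_sub_mem {X : AddMonoid.End M} {W : AddSubgroup M}
    (hW : ∀ w ∈ W, X w ∈ W) {d : M} (ht : X (X d - d) - (X d - d) ∈ W) (n : ℕ) :
    (∑ i ∈ range n, X ^ i) d - (n • d + n.choose 2 • (X d - d)) ∈ W := by
  induction n with
  | zero => simp
  | succ n ih =>
    have h := add_mem ih (pow_apply_sub_mem hW ht n)
    rw [sum_range_succ, Nat.choose_succ_succ' n 1,
      show ((∑ i ∈ range n, X ^ i) + X ^ n) d = (∑ i ∈ range n, X ^ i) d + (X ^ n) d from rfl]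
    convert h using 1
    simp only [Nat.choose_one_right, add_smul, one_smul]
    abel

theorem geom_sum_apply_sub_nsmul_mem {p : ℕ} (hp : p.Prime) (hodd : Odd p)
    {X : AddMonoid.End M} {W : AddSubgroup M}
    (hW : ∀ w ∈ W, X w ∈ W) {d : M} (ht : X (X d - d) - (X d - d) ∈ W)
    (hpt : p • (X d - d) ∈ W) :
    (∑ i ∈ range p, X ^ i) d - p • d ∈ W := by
  have h2 : 2 < p := by
    rcases hp.two_le.lt_or_eq with h | h
    · exact h
    · subst h; exact absurd hodd (by decide)
  obtain ⟨k, hk⟩ := hp.dvd_choose_self two_ne_zero h2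
  have h := add_mem (geom_sum_apply_sub_mem hW ht p) (nsmul_mem hpt k)
  rw [hk] at h
  convert h using 1
  rw [mul_comm, mul_smul]
  abel

theorem nsmul_mem_of_geom_sum_apply_mem {p : ℕ} (hp : p.Prime) (hodd : Odd p)
    {X : AddMonoid.End M} {W : AddSubgroup M} (hW : ∀ w ∈ W, X w ∈ W)
    (hP : ∀ d, p • d ∈ W → X d - d ∈ W) {d : M} {n : ℕ} (hn : p ^ (n + 1) • d ∈ W)
    (hd : (∑ i ∈ range p, X ^ i) d ∈ W) : p • d ∈ W := by
  induction n with
  | zero => simpa using hn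
  | succ n ih =>
    apply ih
    have hpe : p • p • p ^ n • d ∈ W := by
      convert hn using 1
      simp only [smul_smul]
      ring_nf
    have h1 : p • (X (p ^ n • d) - p ^ n • d) ∈ W := by
      have := hP _ hpe
      rwa [map_nsmul, ← smul_sub] at this
    have h2 := geom_sum_apply_sub_nsmul_mem hp hodd hW (hP _ h1) h1
    have h3 : (∑ i ∈ range p, X ^ i) (p ^ n • d) ∈ W := by
      rw [map_nsmul]; exact nsmul_mem hd _
    have h4 := sub_mem h3 h2
    convert h4 using 1
    rw [sub_sub_cancel, smul_smul, pow_succ']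

theorem AddMonoidHom.ker_le_range_of_ker_le_range [Finite M] {A B : M →+ M}
    (hAB : ∀ m, B (A m) = 0) (h : A.ker ≤ B.range) : B.ker ≤ A.range := by
  have hA := A.ker.card_mul_index
  have hB := B.ker.card_mul_index
  rw [AddSubgroup.index_ker] at hA hB
  have h1 : Nat.card A.ker ≤ Nat.card B.range := AddSubgroup.card_le_of_le h
  have h2 : A.range ≤ B.ker := by
    rintro _ ⟨m, rfl⟩
    exact hAB m
  have h3 : Nat.card B.ker ≤ Nat.card A.range := by
    have : 0 < Nat.card B.range := Nat.card_pos
    by_contra! hlt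
    have h5 : 0 < Nat.card A.range := Nat.card_pos
    nlinarith
  exact (AddSubgroup.eq_of_le_of_card_ge h2 h3).ge

variable [Finite M] {p : ℕ} {X Y : AddMonoid.End M} {W : AddSubgroup M}

theorem geom_sum_apply_surjective_of_H1 (hXp : X ^ p = 1) (hXY : X * Y = Y * X)
    (H1 : ∀ u v, (∑ i ∈ range p, X ^ i) u = 0 → (∑ i ∈ range p, Y ^ i) v = 0 →
      Y u - u = X v - v → ∃ a, u = X a - a ∧ v = Y a - a)
    {z : M} (hX : X z = z) (hY : Y z = z) :
    ∃ c, Y c = c ∧ (∑ i ∈ range p, X ^ i) c = z := by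
  set S := ∑ i ∈ range p, X ^ i with hS
  let C : AddSubgroup M := (Y - 1 : AddMonoid.End M).ker
  have hC : ∀ c, c ∈ C ↔ Y c = c := fun c => (sub_eq_zero : Y c - c = 0 ↔ _)
  have hcX : Commute Y X := hXY.symm
  have hcS : Commute Y S := Commute.sum_right _ _ _ fun i _ => hcX.pow_right i
  have key : ∀ {T : AddMonoid.End M}, Commute Y T → ∀ c : C, T c ∈ C := by
    intro T hT c
    rw [hC]
    have h : Y (T c) = T (Y c) := DFunLike.congr_fun hT.eq (c : M)
    rw [h, (hC _).1 c.2]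
  let A : C →+ C := (AddMonoidHom.comp S C.subtype).codRestrict C (key hcS)
  let B : C →+ C := (AddMonoidHom.comp (X - 1 : AddMonoid.End M) C.subtype).codRestrict C
    (key (hcX.sub_right (Commute.one_right _)))
  have hAB : ∀ m, B (A m) = 0 := fun m => by
    ext
    have : (X - 1) * S = 0 := by rw [hS, mul_geom_sum, hXp, sub_self]
    exact DFunLike.congr_fun this (m : M)
  have h : A.ker ≤ B.range := by
    intro c hc
    have hc0 : S c = 0 := congrArg Subtype.val hc
    obtain ⟨a, ha1, ha2⟩ := H1 c 0 hc0 (map_zero _) (by simp [(hC _).1 c.2])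
    refine ⟨⟨a, (hC _).2 (sub_eq_zero.1 ha2.symm)⟩, ?_⟩
    ext
    exact ha1.symm
  obtain ⟨c, hc⟩ := AddMonoidHom.ker_le_range_of_ker_le_range hAB h
    (show (⟨z, (hC z).2 hY⟩ : C) ∈ B.ker from by
      rw [AddMonoidHom.mem_ker]; ext; exact sub_eq_zero.2 hX)
  exact ⟨c, (hC _).1 c.2, congrArg Subtype.val hc⟩

theorem exists_sub_eq_of_H1 (hXp : X ^ p = 1) (hXY : X * Y = Y * X)
    (H1 : ∀ u v, (∑ i ∈ range p, X ^ i) u = 0 → (∑ i ∈ range p, Y ^ i) v = 0 →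
      Y u - u = X v - v → ∃ a, u = X a - a ∧ v = Y a - a)
    {v w : M} (hv : (∑ i ∈ range p, Y ^ i) v = 0) (hw : X v - v = Y w - w) :
    ∃ a, v = Y a - a := by
  set S := ∑ i ∈ range p, X ^ i with hS
  have hcS : Commute Y S :=
    Commute.sum_right _ _ _ fun i _ => (show Commute Y X from hXY.symm).pow_right i
  have h1 : X (S w) = S w := by
    have : (X - 1) * S = 0 := by rw [hS, mul_geom_sum, hXp, sub_self]
    exact sub_eq_zero.1 (DFunLike.congr_fun this w)
  have h2 : Y (S w) = S w := by
    have e1 : Y (S w) = S (Y w) := DFunLike.congr_fun hcS.eq w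
    have e2 : S (X v - v) = 0 := by
      have : S * (X - 1) = 0 := by rw [hS, geom_sum_mul, hXp, sub_self]
      exact DFunLike.congr_fun this v
    rw [hw, map_sub] at e2
    rw [e1, sub_eq_zero.1 e2]
  obtain ⟨c, hc1, hc2⟩ := geom_sum_apply_surjective_of_H1 hXp hXY H1 h1 h2
  obtain ⟨a, -, ha⟩ := H1 (w - c) v (by rw [map_sub, hc2, sub_self]) hv
    (by rw [hw, map_sub, hc1]; abel)
  exact ⟨a, ha⟩

theorem fixed_iff_nsmul_of_H1 (hp : p.Prime) (hodd : Odd p)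
    (hXp : X ^ p = 1) (hYp : Y ^ p = 1) (hXY : X * Y = Y * X)
    (hW : ∀ w, w ∈ W ↔ X w = w ∧ Y w = w) {n : ℕ} (hn : ∀ d : M, p ^ (n + 1) • d = 0)
    (hP : ∀ d, p • d ∈ W → X d - d ∈ W ∧ Y d - d ∈ W)
    (H1 : ∀ u v, (∑ i ∈ range p, X ^ i) u = 0 → (∑ i ∈ range p, Y ^ i) v = 0 →
      Y u - u = X v - v → ∃ a, u = X a - a ∧ v = Y a - a) (c : M) :
    Y c = c ↔ ∃ d, p • d = c := by
  set S := ∑ i ∈ range p, Y ^ i with hS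
  have hWY : ∀ w ∈ W, Y w ∈ W := fun w hw => by rwa [((hW w).1 hw).2]
  have hbot : ∀ w ∈ (⊥ : AddSubgroup M), Y w ∈ (⊥ : AddSubgroup M) := fun w hw => by
    rw [AddSubgroup.mem_bot.1 hw, map_zero]; exact zero_mem _
  -- On the elements whose `p`-th multiple lies in `W`, the norm is multiplication by `p`
  have hnorm : ∀ d, p • d ∈ W → S d = p • d := by
    intro d hd
    refine sub_eq_zero.1 (AddSubgroup.mem_bot.1
      (geom_sum_apply_sub_nsmul_mem hp hodd hbot ?_ ?_))
    · rw [((hW _).1 (hP d hd).2).2, sub_self]; exact zero_mem _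
    · rw [smul_sub, ← map_nsmul, ((hW _).1 hd).2, sub_self]; exact zero_mem _
  have hker : ∀ d, S d = 0 ↔ p • d = 0 := by
    intro d
    constructor
    · intro h
      have hd := nsmul_mem_of_geom_sum_apply_mem hp hodd hWY (fun d hd => (hP d hd).2)
        (by rw [hn d]; exact zero_mem _) (show S d ∈ W by rw [h]; exact zero_mem _)
      rw [← hnorm d hd, h]
    · intro h
      rw [hnorm d (by rw [h]; exact zero_mem _), h]
  have hrange : ∀ d, p • (Y d - d) = 0 := by
    intro d
    rw [← hker]
    have : S * (Y - 1) = 0 := by rw [hS, geom_sum_mul, hYp, sub_self]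
    exact DFunLike.congr_fun this d
  have hfix : ∀ v ∈ W, p • v = 0 → ∃ a, v = Y a - a := by
    intro v hv h
    refine exists_sub_eq_of_H1 hXp hXY H1 (w := 0) ((hker v).2 h) ?_
    simp [((hW v).1 hv).1]
  have htors : ∀ v, p • v = 0 → ∃ a, v = Y a - a := by
    intro v h
    obtain ⟨w, hw⟩ := hfix (X v - v) (hP v (by rw [h]; exact zero_mem _)).1
      (by rw [smul_sub, ← map_nsmul, h, map_zero, sub_zero])
    exact exists_sub_eq_of_H1 hXp hXY H1 ((hker v).2 h) hw
  constructor
  · intro hc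
    obtain ⟨d, hd⟩ := AddMonoidHom.ker_le_range_of_ker_le_range
      (A := nsmulAddMonoidHom p) (B := (Y - 1 : AddMonoid.End M))
      (fun m => by
        have := hrange m
        rw [smul_sub, ← map_nsmul] at this
        exact this)
      (fun v hv => by
        obtain ⟨a, ha⟩ := htors v hv
        exact ⟨a, ha.symm⟩)
      (show c ∈ _ from sub_eq_zero.2 hc)
    exact ⟨d, hd⟩
  · rintro ⟨d, rfl⟩
    have := hrange d
    rw [smul_sub, ← map_nsmul] at this
    exact sub_eq_zero.1 this

theorem fixed_eq_bot_of_H1 (hp : p.Prime) (hodd : Odd p)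
    (hXp : X ^ p = 1) (hYp : Y ^ p = 1) (hXY : X * Y = Y * X)
    (hW : ∀ w, w ∈ W ↔ X w = w ∧ Y w = w) {n : ℕ} (hn : ∀ d : M, p ^ (n + 1) • d = 0)
    (hP : ∀ d, p • d ∈ W → X d - d ∈ W ∧ Y d - d ∈ W)
    (H1 : ∀ u v, (∑ i ∈ range p, X ^ i) u = 0 → (∑ i ∈ range p, Y ^ i) v = 0 →
      Y u - u = X v - v → ∃ a, u = X a - a ∧ v = Y a - a) : W = ⊥ := by
  have hY := fixed_iff_nsmul_of_H1 hp hodd hXp hYp hXY hW hn hP H1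
  have hX := fixed_iff_nsmul_of_H1 hp hodd hYp hXp hXY.symm
    (fun w => (hW w).trans and_comm) hn (fun d hd => (hP d hd).symm)
    (fun u v hu hv h => by
      obtain ⟨a, h1, h2⟩ := H1 v u hv hu h.symm
      exact ⟨a, h2, h1⟩)
  have hdiv : ∀ z ∈ W, ∃ w ∈ W, p • w = z := by
    intro z hz
    obtain ⟨hz1, hz2⟩ := (hW z).1 hz
    obtain ⟨c, hc, hcz⟩ := geom_sum_apply_surjective_of_H1 hXp hXY H1 hz1 hz2
    have hcX : X c = c := (hX c).2 ((hY c).1 hc)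
    refine ⟨c, (hW c).2 ⟨hcX, hc⟩, ?_⟩
    have h0 : X c - c = 0 := sub_eq_zero.2 hcX
    have h := geom_sum_apply_sub_nsmul_mem (X := X) (W := ⊥) (d := c) hp hodd
      (fun w hw => by rw [AddSubgroup.mem_bot.1 hw, map_zero]; exact zero_mem _)
      (by simp [h0]) (by simp [h0])
    rw [← hcz, ← sub_eq_zero.1 (AddSubgroup.mem_bot.1 h)]
  have hdiv' : ∀ k, ∀ z ∈ W, ∃ w ∈ W, p ^ k • w = z := by
    intro k
    induction k with
    | zero => exact fun z hz => ⟨z, hz, by simp⟩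
    | succ k ih =>
      intro z hz
      obtain ⟨w, hw, rfl⟩ := ih z hz
      obtain ⟨x, hx, rfl⟩ := hdiv w hw
      exact ⟨x, hx, by rw [pow_succ, mul_smul]⟩
  rw [eq_bot_iff]
  intro z hz
  obtain ⟨w, -, rfl⟩ := hdiv' (n + 1) z hz
  rw [hn]
  exact zero_mem _

end Bicyclic

section CrossedHom

open Finset

variable {M : Type*} [AddCommGroup M] {p : ℕ} {X Y : AddMonoid.End M}

theorem geom_sum_add_apply (X : AddMonoid.End M) (m n : ℕ) (u : M) :
    (∑ i ∈ range (m + n), X ^ i) u =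
      (X ^ n) ((∑ i ∈ range m, X ^ i) u) + (∑ i ∈ range n, X ^ i) u := by
  have h : ∑ i ∈ range (m + n), X ^ i
      = X ^ n * ∑ i ∈ range m, X ^ i + ∑ i ∈ range n, X ^ i := by
    rw [add_comm m n, sum_range_add, mul_sum, add_comm]
    simp only [pow_add]
  exact DFunLike.congr_fun h u

theorem geom_sum_apply_eq_of_modEq {u : M} (hu : (∑ i ∈ range p, X ^ i) u = 0) {m n : ℕ}
    (h : m ≡ n [MOD p]) : (∑ i ∈ range m, X ^ i) u = (∑ i ∈ range n, X ^ i) u := by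
  have hper : Function.Periodic (fun m => (∑ i ∈ range m, X ^ i) u) p := fun m => by
    simp only
    rw [add_comm, geom_sum_add_apply, hu, map_zero, zero_add]
  rw [← hper.map_mod_nat m, ← hper.map_mod_nat n, h]

/-- The value at `x ^ m * y ^ n` of the crossed homomorphism sending `x` to `u` and `y` to `v`,
where `x` and `y` act through `X` and `Y`. -/
def bicyclicCrossedHom (X Y : AddMonoid.End M) (u v : M) (m n : ℕ) : M :=
  (Y ^ n) ((∑ i ∈ range m, X ^ i) u) + (∑ i ∈ range n, Y ^ i) v

theorem bicyclicCrossedHom_eq_of_modEq (hYp : Y ^ p = 1) {u v : M}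
    (hu : (∑ i ∈ range p, X ^ i) u = 0)
    (hv : (∑ i ∈ range p, Y ^ i) v = 0) {m m' n n' : ℕ} (hm : m ≡ m' [MOD p])
    (hn : n ≡ n' [MOD p]) :
    bicyclicCrossedHom X Y u v m n = bicyclicCrossedHom X Y u v m' n' := by
  rw [bicyclicCrossedHom, bicyclicCrossedHom, geom_sum_apply_eq_of_modEq hu hm,
    geom_sum_apply_eq_of_modEq hv hn, pow_eq_pow_mod n hYp, pow_eq_pow_mod n' hYp,
    show n % p = n' % p from hn]

theorem bicyclicCrossedHom_add (hXY : X * Y = Y * X) {u v : M} (huv : Y u - u = X v - v)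
    (m m' n n' : ℕ) :
    bicyclicCrossedHom X Y u v (m + m') (n + n') =
      (Y ^ n' * X ^ m') (bicyclicCrossedHom X Y u v m n) + bicyclicCrossedHom X Y u v m' n' := by
  have hc : Commute X Y := hXY
  have hcross : (Y ^ n) ((∑ i ∈ range m', X ^ i) u) - (∑ i ∈ range m', X ^ i) u =
      (X ^ m') ((∑ i ∈ range n, Y ^ i) v) - (∑ i ∈ range n, Y ^ i) v := by
    set S := ∑ i ∈ range m', X ^ i with hS
    set T := ∑ i ∈ range n, Y ^ i with hT
    have hST : Commute S T := Commute.sum_left _ _ _ fun i _ =>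
      Commute.sum_right _ _ _ fun j _ => hc.pow_pow i j
    have hSY : Commute S Y := Commute.sum_left _ _ _ fun i _ => hc.pow_left i
    have e1 : (Y ^ n - 1) * S = S * T * (Y - 1) := by
      rw [mul_assoc, hT, geom_sum_mul,
        ((hSY.pow_right n).sub_right (Commute.one_right _)).eq]
    have e2 : (X ^ m' - 1) * T = S * T * (X - 1) := by
      have hTX : Commute T (X - 1) := (Commute.sum_left _ _ _ fun i _ =>
        (hc.symm.pow_left i)).sub_right (Commute.one_right _)
      rw [mul_assoc, hTX.eq, ← mul_assoc, hS, geom_sum_mul]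
    have f1 : (Y ^ n) (S u) - S u = S (T (Y u - u)) := DFunLike.congr_fun e1 u
    have f2 : (X ^ m') (T v) - T v = S (T (X v - v)) := DFunLike.congr_fun e2 v
    rw [f1, f2, huv]
  have hYX : ∀ w, (X ^ m') ((Y ^ n) w) = (Y ^ n) ((X ^ m') w) := fun w =>
    DFunLike.congr_fun (hc.pow_pow m' n).eq w
  have hYY : ∀ w, (Y ^ (n + n')) w = (Y ^ n') ((Y ^ n) w) := fun w => by
    rw [add_comm, pow_add]; rfl
  simp only [bicyclicCrossedHom, geom_sum_add_apply, hYY,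
    show ∀ w, (Y ^ n' * X ^ m') w = (Y ^ n') ((X ^ m') w) from fun _ => rfl, map_add, hYX]
  have h := congrArg (Y ^ n') hcross
  simp only [map_sub] at h
  rw [sub_eq_sub_iff_add_eq_add] at h
  generalize (Y ^ n') ((Y ^ n) ((X ^ m') ((∑ i ∈ range m, X ^ i) u))) = q1 at *
  have := congrArg (fun t => q1 + t + (∑ i ∈ range n', Y ^ i) v) h
  convert this using 1 <;> abel

end CrossedHom

open scoped IsMulCommutative

section Group

variable {G : Type*} [Group G]

theorem IsPGroup.index_eq_of_isCoatom [Finite G] {p : ℕ} [Fact p.Prime] (hG : IsPGroup p G)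
    {K : Subgroup G} [K.Normal] (hK : IsCoatom K) : K.index = p := by
  have hQ : IsPGroup p (G ⧸ K) := hG.to_quotient K
  have hnt : Nontrivial (G ⧸ K) := QuotientGroup.nontrivial_iff.2 hK.1
  have hdvd : p ∣ Nat.card (G ⧸ K) := hQ.card_eq_or_dvd.resolve_left Finite.one_lt_card.ne'
  obtain ⟨q, hq⟩ := exists_prime_orderOf_dvd_card' p hdvd
  have htop : (Subgroup.zpowers q).comap (QuotientGroup.mk' K) = ⊤ := by
    refine hK.2 _ (lt_of_le_of_ne ?_ ?_)
    · intro k hk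
      rw [Subgroup.mem_comap, QuotientGroup.mk'_apply, (QuotientGroup.eq_one_iff k).2 hk]
      exact one_mem _
    · intro h
      obtain ⟨g, rfl⟩ := QuotientGroup.mk_surjective q
      have hg : g ∈ K := by
        rw [h]; exact Subgroup.mem_zpowers _
      rw [(QuotientGroup.eq_one_iff g).2 hg, orderOf_one] at hq
      exact (Fact.out : p.Prime).one_lt.ne hq
  have htop' : Subgroup.zpowers q = ⊤ :=
    Subgroup.comap_injective (QuotientGroup.mk'_surjective K) (by rw [htop, Subgroup.comap_top])
  rw [Subgroup.index, ← hq, ← Nat.card_zpowers, htop', Subgroup.card_top]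

theorem exists_isCoatom_ne_of_not_isCyclic {Q : Type*} [Group Q] [Finite Q] (h : ¬ IsCyclic Q) :
    ∃ K₁ K₂ : Subgroup Q, IsCoatom K₁ ∧ IsCoatom K₂ ∧ K₁ ≠ K₂ := by
  have hz : ∀ q : Q, Subgroup.zpowers q ≠ ⊤ := fun q hq =>
    h ⟨q, fun r => show r ∈ Subgroup.zpowers q from hq ▸ Subgroup.mem_top r⟩
  obtain ⟨K₁, hK₁, -⟩ := (eq_top_or_exists_le_coatom (Subgroup.zpowers (1 : Q))).resolve_left (hz 1)
  obtain ⟨q, -, hq⟩ := SetLike.exists_of_lt hK₁.lt_top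
  obtain ⟨K₂, hK₂, hle⟩ := (eq_top_or_exists_le_coatom (Subgroup.zpowers q)).resolve_left (hz q)
  exact ⟨K₁, K₂, hK₁, hK₂, fun e => hq (e ▸ hle (Subgroup.mem_zpowers q))⟩

theorem IsPGroup.exists_normal_index_eq_of_not_isCyclic [Finite G] {p : ℕ} [Fact p.Prime]
    (hG : IsPGroup p G) {N : Subgroup G} [N.Normal] (h : ¬ IsCyclic (G ⧸ N)) :
    ∃ K₁ K₂ : Subgroup G, K₁.Normal ∧ K₂.Normal ∧ K₁.index = p ∧ K₂.index = p ∧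
      N ≤ K₁ ∧ N ≤ K₂ ∧ ¬ K₁ ≤ K₂ ∧ ¬ K₂ ≤ K₁ := by
  have hnil : Group.IsNilpotent G := hG.isNilpotent
  obtain ⟨K₁, K₂, h₁, h₂, hne⟩ := exists_isCoatom_ne_of_not_isCyclic h
  have hs := QuotientGroup.mk'_surjective N
  have hle : ∀ K : Subgroup (G ⧸ N), N ≤ K.comap (QuotientGroup.mk' N) := fun K n hn => by
    rw [Subgroup.mem_comap, QuotientGroup.mk'_apply, (QuotientGroup.eq_one_iff n).2 hn]
    exact one_mem _
  have c₁ := Subgroup.isCoatom_comap_of_surjective hs h₁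
  have c₂ := Subgroup.isCoatom_comap_of_surjective hs h₂
  have hne' := (Subgroup.comap_injective hs).ne hne
  have n₁ := Subgroup.NormalizerCondition.normal_of_coatom _
    Group.normalizerCondition_of_isNilpotent c₁
  have n₂ := Subgroup.NormalizerCondition.normal_of_coatom _
    Group.normalizerCondition_of_isNilpotent c₂
  exact ⟨_, _, n₁, n₂, hG.index_eq_of_isCoatom c₁, hG.index_eq_of_isCoatom c₂, hle _, hle _,
    fun h => hne' (c₁.le_iff_eq c₂.1 |>.1 h).symm, fun h => hne' (c₂.le_iff_eq c₁.1 |>.1 h)⟩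

theorem IsPGroup.exists_mem_center_of_normal [Finite G] {p : ℕ} [Fact p.Prime]
    (hG : IsPGroup p G) {N : Subgroup G} [N.Normal] (hN : N ≠ ⊥) :
    ∃ z ∈ N, z ∈ Subgroup.center G ∧ z ≠ 1 := by
  let _ : MulAction G N := MulAction.compHom N (MulAut.conjNormal : G →* MulAut N)
  have hnt : Nontrivial N := (Subgroup.nontrivial_iff_ne_bot N).2 hN
  have hdvd : p ∣ Nat.card N :=
    (hG.to_subgroup N).card_eq_or_dvd.resolve_left Finite.one_lt_card.ne'
  have hfix : (1 : N) ∈ MulAction.fixedPoints G N := fun g =>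
    map_one (MulAut.conjNormal g : MulAut N)
  obtain ⟨z, hz, hz1⟩ := hG.exists_fixed_point_of_prime_dvd_card_of_fixed_point N hdvd hfix
  refine ⟨z, z.2, Subgroup.mem_center_iff.2 fun g => ?_, fun h => hz1 (Subtype.ext h.symm)⟩
  have h : ((MulAut.conjNormal g : MulAut N) z : G) = z := congrArg Subtype.val (hz g)
  rw [MulAut.conjNormal_apply] at h
  exact mul_inv_eq_iff_eq_mul.1 h

/-- Conjugation `d ↦ g⁻¹ * d * g` on an abelian normal subgroup, written additively. -/
def Subgroup.conjEnd (D : Subgroup G) [D.Normal] [IsMulCommutative D] (g : G) :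
    AddMonoid.End (Additive D) :=
  MonoidHom.toAdditive (MulAut.conjNormal g⁻¹ : MulAut D).toMonoidHom

namespace Subgroup

variable {D : Subgroup G} [D.Normal] [IsMulCommutative D]

theorem coe_conjEnd (g : G) (d : Additive D) :
    ((D.conjEnd g d).toMul : G) = g⁻¹ * (d.toMul : G) * g := by
  have h : ((MulAut.conjNormal g⁻¹ : MulAut D) d.toMul : G) = _ := MulAut.conjNormal_apply _ _
  rw [inv_inv] at h
  exact h

theorem conjEnd_eq_iff {g : G} {d : Additive D} :
    D.conjEnd g d = d ↔ (d.toMul : G) * g = g * d.toMul := by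
  rw [← Additive.toMul.injective.eq_iff, ← Subtype.val_inj, coe_conjEnd, mul_assoc,
    inv_mul_eq_iff_eq_mul]

theorem conjEnd_mul (g h : G) : D.conjEnd (g * h) = D.conjEnd h * D.conjEnd g := by
  ext d
  change ((D.conjEnd (g * h) d).toMul : G) = ((D.conjEnd h (D.conjEnd g d)).toMul : G)
  simp only [coe_conjEnd]
  group

theorem conjEnd_eq_one {g : G} (hg : g ∈ centralizer (D : Set G)) : D.conjEnd g = 1 := by
  refine AddMonoidHom.ext fun d => ?_
  exact conjEnd_eq_iff.2 (mem_centralizer_iff.1 hg _ d.toMul.2)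

theorem conjEnd_pow (g : G) (n : ℕ) : D.conjEnd (g ^ n) = D.conjEnd g ^ n := by
  induction n with
  | zero => rw [pow_zero, pow_zero]; exact conjEnd_eq_one (one_mem _)
  | succ n ih => rw [pow_succ, conjEnd_mul, ih, pow_succ']

theorem coe_conjEnd_sub (g : G) (d : Additive D) :
    ((D.conjEnd g d - d).toMul : G) = (d.toMul : G)⁻¹ * (g⁻¹ * (d.toMul : G) * g) := by
  rw [← coe_conjEnd]
  exact congrArg (fun e : Additive D => (e.toMul : G)) (sub_eq_neg_add (D.conjEnd g d) d)

end Subgroup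

/-- Coordinates with respect to `x` modulo a normal subgroup of prime index. -/
theorem exists_quotient_coordinate {p : ℕ} [Fact p.Prime] {K : Subgroup G} [K.Normal]
    (hK : K.index = p) {x : G} (hx : x ∉ K) :
    ∃ i : G → ℕ, (∀ g, (x ^ i g)⁻¹ * g ∈ K) ∧ (∀ g h, i (g * h) ≡ i g + i h [MOD p]) ∧
      (∀ k ∈ K, i k ≡ 0 [MOD p]) ∧ i x ≡ 1 [MOD p] := by
  have hcard : Nat.card (G ⧸ K) = p := hK
  have hx1 : (x : G ⧸ K) ≠ 1 := fun h => hx ((QuotientGroup.eq_one_iff x).1 h)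
  have hfin : Finite (G ⧸ K) :=
    Nat.finite_of_card_ne_zero (hcard ▸ (Fact.out : p.Prime).ne_zero)
  have hord : orderOf (x : G ⧸ K) = p :=
    orderOf_eq_card_of_forall_mem_zpowers (fun g => mem_zpowers_of_prime_card hcard hx1) |>.trans
      hcard
  have hex : ∀ g : G, ∃ i : ℕ, (x : G ⧸ K) ^ i = g := fun g =>
    mem_powers_of_prime_card hcard hx1
  choose i hi using hex
  have hmod : ∀ m n, (x : G ⧸ K) ^ m = (x : G ⧸ K) ^ n → m ≡ n [MOD p] := fun m n h => by
    rwa [pow_eq_pow_iff_modEq, hord] at h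
  refine ⟨i, fun g => ?_, fun g h => hmod _ _ ?_, fun k hk => hmod _ _ ?_, hmod _ _ ?_⟩
  · rw [← QuotientGroup.eq_one_iff, QuotientGroup.mk_mul, QuotientGroup.mk_inv,
      QuotientGroup.mk_pow, hi, inv_mul_cancel]
  · rw [pow_add, hi, hi, hi, QuotientGroup.mk_mul]
  · rw [hi, pow_zero, (QuotientGroup.eq_one_iff k).2 hk]
  · rw [hi, pow_one]

end Group

/-- Let `p` be odd and `G` a finite `p`-group with `G/Z(G)`
`p`-central, and let `N` be a nontrivial normal subgroup with `G/N` non-cyclic.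
Then there is a non-principal crossed homomorphism of `G/N` with values in
`Z(N)`; i.e. `H¹(G/N, Z(N)) ≠ 0`. -/
theorem stmt18 {p : ℕ} (hp : p.Prime) (hodd : Odd p) (G : Type*) [Group G] [Finite G]
    (hpG : IsPGroup p G)
    (hcent : ∀ x : G ⧸ Subgroup.center G, x ^ p = 1 →
      x ∈ Subgroup.center (G ⧸ Subgroup.center G))
    (N : Subgroup G) (hN : N.Normal) (hnt : N ≠ ⊥)
    (hnc : ¬ IsCyclic (G ⧸ N)) :
    ∃ f : G → G,
      (∀ g : G, f g ∈ N ∧ ∀ m ∈ N, f g * m = m * f g) ∧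
      (∀ x y : G, f (x * y) = y⁻¹ * f x * y * f y) ∧
      (∀ n ∈ N, f n = 1) ∧
      ¬ ∃ a : G, (a ∈ N ∧ ∀ m ∈ N, a * m = m * a) ∧
        ∀ g : G, f g = a⁻¹ * (g⁻¹ * a * g) := by
  have : Fact p.Prime := ⟨hp⟩
  by_contra hcon
  push Not at hcon
  obtain ⟨K₁, K₂, hK₁, hK₂, hi₁, hi₂, hN₁, hN₂, h12, h21⟩ :=
    hpG.exists_normal_index_eq_of_not_isCyclic hnc
  obtain ⟨x, hx₂, hx₁⟩ := SetLike.not_le_iff_exists.1 h21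
  obtain ⟨y, hy₁, hy₂⟩ := SetLike.not_le_iff_exists.1 h12
  obtain ⟨i, hi, hi_mul, hi_mem, hix⟩ := exists_quotient_coordinate hi₁ hx₁
  obtain ⟨j, hj, hj_mul, hj_mem, hjy⟩ := exists_quotient_coordinate hi₂ hy₂
  let L : Subgroup G := K₁ ⊓ K₂
  let D : Subgroup G := N ⊓ Subgroup.centralizer (L : Set G)
  have hNL : N ≤ L := le_inf hN₁ hN₂
  have hDmem : ∀ d ∈ D, ∀ l ∈ L, l * d = d * l := fun d hd l hl =>
    Subgroup.mem_centralizer_iff.1 hd.2 l hl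
  have hcommD : IsMulCommutative D :=
    ⟨⟨fun a b => Subtype.ext (hDmem b b.2 a (hNL a.2.1))⟩⟩
  have hLact : ∀ l ∈ L, D.conjEnd l = 1 := fun l hl => Subgroup.conjEnd_eq_one
    (Subgroup.mem_centralizer_iff.2 fun d hd => (hDmem d hd l hl).symm)
  set X := D.conjEnd x with hX
  set Y := D.conjEnd y with hY
  have hact : ∀ g, D.conjEnd g = Y ^ j g * X ^ i g := by
    intro g
    have hl : (x ^ i g * y ^ j g)⁻¹ * g ∈ L := by
      constructor
      · rw [mul_inv_rev, mul_assoc]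
        exact K₁.mul_mem (K₁.inv_mem (K₁.pow_mem hy₁ _)) (hi g)
      · have h : (x ^ i g * y ^ j g)⁻¹ * g =
            ((y ^ j g)⁻¹ * (x ^ i g)⁻¹ * y ^ j g) * ((y ^ j g)⁻¹ * g) := by group
        rw [h]
        exact K₂.mul_mem (hK₂.conj_mem' _ (K₂.inv_mem (K₂.pow_mem hx₂ _)) _) (hj g)
    have hg : g = x ^ i g * y ^ j g * ((x ^ i g * y ^ j g)⁻¹ * g) := by group
    conv_lhs => rw [hg]
    rw [Subgroup.conjEnd_mul, hLact _ hl, one_mul, Subgroup.conjEnd_mul, Subgroup.conjEnd_pow,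
      Subgroup.conjEnd_pow]
  have hxL : x ^ p ∈ L := ⟨hi₁ ▸ K₁.pow_index_mem x, K₂.pow_mem hx₂ p⟩
  have hyL : y ^ p ∈ L := ⟨K₁.pow_mem hy₁ p, hi₂ ▸ K₂.pow_index_mem y⟩
  have hXp : X ^ p = 1 := by rw [hX, ← Subgroup.conjEnd_pow, hLact _ hxL]
  have hYp : Y ^ p = 1 := by rw [hY, ← Subgroup.conjEnd_pow, hLact _ hyL]
  have hXY : X * Y = Y * X := by
    have hl : (x * y)⁻¹ * (y * x) ∈ L := by
      have h : (x * y)⁻¹ * (y * x) = y⁻¹ * (x⁻¹ * y * x) := by group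
      have h' : (x * y)⁻¹ * (y * x) = (y⁻¹ * x⁻¹ * y) * x := by group
      exact ⟨h ▸ K₁.mul_mem (K₁.inv_mem hy₁) (hK₁.conj_mem' _ hy₁ _),
        h' ▸ K₂.mul_mem (hK₂.conj_mem' _ (K₂.inv_mem hx₂) _) hx₂⟩
    have hg : y * x = x * y * ((x * y)⁻¹ * (y * x)) := by group
    rw [hX, hY, ← Subgroup.conjEnd_mul, ← Subgroup.conjEnd_mul, hg, Subgroup.conjEnd_mul (x * y),
      hLact _ hl, one_mul]
  let W : AddSubgroup (Additive D) :=
    AddMonoidHom.ker (X - 1 : AddMonoid.End (Additive D)) ⊓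
      AddMonoidHom.ker (Y - 1 : AddMonoid.End (Additive D))
  have hW : ∀ w, w ∈ W ↔ X w = w ∧ Y w = w := fun w =>
    and_congr (sub_eq_zero : X w - w = 0 ↔ _) (sub_eq_zero : Y w - w = 0 ↔ _)
  have hWcenter : ∀ w : Additive D, w ∈ W ↔ (w.toMul : G) ∈ Subgroup.center G := by
    intro w
    rw [hW, Subgroup.mem_center_iff]
    constructor
    · rintro ⟨h1, h2⟩ g
      have hfix : ∀ {T : AddMonoid.End (Additive D)}, T w = w → ∀ n, (T ^ n) w = w := by
        intro T hT n
        induction n with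
        | zero => rfl
        | succ n ih => rw [pow_succ, show (T ^ n * T) w = (T ^ n) (T w) from rfl, hT, ih]
      refine (Subgroup.conjEnd_eq_iff.1 ?_).symm
      rw [hact, show (Y ^ j g * X ^ i g) w = (Y ^ j g) ((X ^ i g) w) from rfl, hfix h1, hfix h2]
    · exact fun h => ⟨Subgroup.conjEnd_eq_iff.2 (h x).symm, Subgroup.conjEnd_eq_iff.2 (h y).symm⟩
  have hP : ∀ d, p • d ∈ W → X d - d ∈ W ∧ Y d - d ∈ W := by
    intro d hd
    have hpow : (d.toMul : G) ^ p ∈ Subgroup.center G := (hWcenter _).1 hd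
    have hc := Subgroup.mem_center_iff.1 (hcent ((d.toMul : G) : G ⧸ Subgroup.center G)
      (by rwa [← QuotientGroup.mk_pow, QuotientGroup.eq_one_iff]))
    have hmem : ∀ g, D.conjEnd g d - d ∈ W := by
      intro g
      rw [hWcenter, Subgroup.coe_conjEnd_sub, ← QuotientGroup.eq_one_iff]
      simp only [QuotientGroup.mk_mul, QuotientGroup.mk_inv]
      rw [mul_assoc, ← hc]
      group
    exact ⟨hmem x, hmem y⟩
  have hexp : ∃ n, ∀ d : Additive D, p ^ (n + 1) • d = 0 := by
    obtain ⟨n, hn⟩ := IsPGroup.iff_card.1 (hpG.to_subgroup D)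
    refine ⟨n, fun d => ?_⟩
    have h : d.toMul ^ p ^ (n + 1) = 1 := by
      rw [pow_succ, pow_mul, ← hn, pow_card_eq_one', one_pow]
    exact h
  obtain ⟨n, hn⟩ := hexp
  have hWbot : W = ⊥ := by
    refine fixed_eq_bot_of_H1 hp hodd hXp hYp hXY hW hn hP fun u v hu hv huv => ?_
    let F : G → Additive D := fun g => bicyclicCrossedHom X Y u v (i g) (j g)
    have hF : ∀ g m n, i g ≡ m [MOD p] → j g ≡ n [MOD p] →
        F g = bicyclicCrossedHom X Y u v m n := fun g m n hm hn =>
      bicyclicCrossedHom_eq_of_modEq hYp hu hv hm hn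
    have hFL : ∀ l ∈ L, F l = 0 := fun l hl => by
      rw [hF l 0 0 (hi_mem l hl.1) (hj_mem l hl.2)]
      simp [bicyclicCrossedHom]
    obtain ⟨a, ⟨haN, ha⟩, hFa⟩ := hcon (fun g => ((F g).toMul : G))
      (fun g => ⟨(F g).toMul.2.1, fun m hm => (hDmem _ (F g).toMul.2 m (hNL hm)).symm⟩)
      (fun g h => by
        have e : F (g * h) = D.conjEnd h (F g) + F h := by
          rw [hF _ _ _ (hi_mul g h) (hj_mul g h), bicyclicCrossedHom_add hXY huv, ← hact]
        rw [e, ← Subgroup.coe_conjEnd]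
        rfl)
      (fun m hm => by rw [hFL m (hNL hm)]; rfl)
    have haD : a ∈ D := by
      refine ⟨haN, Subgroup.mem_centralizer_iff.2 fun l hl => ?_⟩
      have h := hFa l
      rw [hFL l hl, show ((Additive.toMul (0 : Additive D) : D) : G) = 1 from rfl, eq_comm,
        inv_mul_eq_one, mul_assoc, eq_inv_mul_iff_mul_eq] at h
      exact h
    have hFa' : ∀ g, F g = D.conjEnd g (Additive.ofMul ⟨a, haD⟩) - Additive.ofMul ⟨a, haD⟩ := by
      intro g
      rw [← Additive.toMul.injective.eq_iff, ← Subtype.val_inj, Subgroup.coe_conjEnd_sub]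
      exact hFa g
    refine ⟨Additive.ofMul ⟨a, haD⟩, ?_, ?_⟩
    · rw [← hFa' x, hF x 1 0 hix (hj_mem x hx₂)]
      simp [bicyclicCrossedHom]
    · rw [← hFa' y, hF y 0 1 (hi_mem y hy₁) hjy]
      simp [bicyclicCrossedHom]
  obtain ⟨z, hzN, hzc, hz1⟩ := hpG.exists_mem_center_of_normal hnt
  have hzD : z ∈ D := ⟨hzN, Subgroup.mem_centralizer_iff.2 fun l _ =>
    Subgroup.mem_center_iff.1 hzc l⟩
  have hzW : Additive.ofMul (⟨z, hzD⟩ : D) ∈ W := (hWcenter _).2 hzc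
  rw [hWbot, AddSubgroup.mem_bot] at hzW
  exact hz1 (congrArg (fun e : Additive D => (e.toMul : G)) hzW)
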